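/- Let δ, γ ∈ ℂ satisfy condition (C): γ = 0, or (δ, γ) = (0, −1). There exist polynomials P₁, P₂, P₃ ∈ ℂ[X, Y, Z] (depending only on δ, γ) such that for every solution (x, y, z) of the reduced three-wave interaction system (1) on a connected open set U ⊆ ℂ with x nonvanishing, the functions x₂ = 1/x, y₂ = −(y + √−1·x)x, z₂ = zx satisfy dx₂/dt = P₁(x₂, y₂, z₂), dy₂/dt = P₂(x₂, y₂, z₂), dz₂/dt = P₃(x₂, y₂, z₂) on U. -/

import Mathlib

open Complex

noncomputable section

/-- A solution of the reduced three-wave interaction dynamical system (1)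
on a set `U ⊆ ℂ`, with parameters `δ γ : ℂ`. -/
def solTWI (δ γ : ℂ) (x y z : ℂ → ℂ) (U : Set ℂ) : Prop :=
  ∀ t ∈ U,
    HasDerivAt x (-2 * (y t) ^ 2 + γ * x t + δ * y t + z t) t ∧
    HasDerivAt y (2 * x t * y t - δ * x t + γ * y t) t ∧
    HasDerivAt z (-2 * x t * z t - 2 * z t) t

theorem stmt6 (δ γ : ℂ) (hC : γ = 0 ∨ (δ = 0 ∧ γ = -1)) :
    ∃ P₁ P₂ P₃ : MvPolynomial (Fin 3) ℂ,
      ∀ (U : Set ℂ), IsOpen U → IsConnected U →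
      ∀ x y z : ℂ → ℂ, solTWI δ γ x y z U → (∀ t ∈ U, x t ≠ 0) →
      ∀ t ∈ U,
        HasDerivAt (fun s => 1 / x s)
          (MvPolynomial.eval ![1 / x t, -(y t + I * x t) * x t, z t * x t] P₁) t ∧
        HasDerivAt (fun s => -(y s + I * x s) * x s)
          (MvPolynomial.eval ![1 / x t, -(y t + I * x t) * x t, z t * x t] P₂) t ∧
        HasDerivAt (fun s => z s * x s)
          (MvPolynomial.eval ![1 / x t, -(y t + I * x t) * x t, z t * x t] P₃) t := by
  let X : MvPolynomial (Fin 3) ℂ := MvPolynomial.X 0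
  let Y : MvPolynomial (Fin 3) ℂ := MvPolynomial.X 1
  let Z : MvPolynomial (Fin 3) ℂ := MvPolynomial.X 2
  let c : ℂ → MvPolynomial (Fin 3) ℂ := MvPolynomial.C
  refine ⟨c 2 * X ^ 4 * Y ^ 2 + c (4 * I) * X ^ 2 * Y - c 2 - c γ * X + c δ * X ^ 3 * Y
      + c (I * δ) * X - Z * X ^ 3,
    c (2 * γ) * Y - c (2 * I) * X * Y ^ 2 - c I * Z - c 2 * X ^ 3 * Y ^ 3 - c δ * X ^ 2 * Y ^ 2
      + X ^ 2 * Y * Z,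
    Z * (-c 2 * X ^ 3 * Y ^ 2 - c (4 * I) * X * Y + c γ - c δ * X ^ 2 * Y - c (I * δ)
      + Z * X ^ 2 - c 2), ?_⟩
  intro U _ _ x y z hsol hx t ht
  obtain ⟨h₁, h₂, h₃⟩ := hsol t ht
  have hxt := hx t ht
  have hI : I ^ 2 = -1 := I_sq
  simp only [X, Y, Z, c, map_add, map_sub, map_mul, map_neg, map_pow, MvPolynomial.eval_C,
    MvPolynomial.eval_X, Matrix.cons_val]
  refine ⟨?_, ?_, ?_⟩
  · simp only [one_div]
    refine (h₁.fun_inv hxt).congr_deriv ?_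
    field_simp
    grind
  · refine ((h₂.fun_add (h₁.const_mul I)).fun_neg.fun_mul h₁).congr_deriv ?_
    field_simp
    grind
  · refine (h₃.fun_mul h₁).congr_deriv ?_
    field_simp
    grind
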